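/- arXiv:1008.4510 — 2 statements merged into one kernel-verified Lean document; each statement's English description precedes it below -/
import Mathlib

section
/- Let n ≥ 1, k ∈ ℕ, N ∈ ℕ. Let g : ℝⁿ → ℂ be of class C^k such that for every multi-index α with |α| ≤ k there is a constant C_α with |∂^α g(x)| ≤ C_α (1+|x|)^{-N} for all x. Let f : ℝⁿ → ℂ be measurable, have vanishing moments of order k, and have decay order N+k+n+1. Let 1 ≤ p ≤ ∞ satisfy N·p > n (this holds automatically when p = ∞). Then there exists a constant C' > 0 such that for all t > 1 one has ‖g ∗ D_t f‖_{L^p(ℝⁿ)} ≤ C' · t^{-k}. -/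
open MeasureTheory SchwartzMap Filter Topology FourierTransform
open scoped ENNReal ContDiff

noncomputable section

/-- Euclidean space ℝⁿ. -/
abbrev Euc (n : ℕ) := EuclideanSpace ℝ (Fin n)

/-- Convolution of two functions on ℝⁿ: (f ∗ g)(x) = ∫ f(y) g(x − y) dy. -/
def conv {n : ℕ} (f g : Euc n → ℂ) : Euc n → ℂ := fun x => ∫ y, f y * g (x - y)

/-- L¹-normalized dilation: (D_t f)(x) = tⁿ f(t x). -/
def dil (n : ℕ) (t : ℝ) (f : Euc n → ℂ) : Euc n → ℂ := fun x => (t ^ n : ℝ) • f (t • x)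

/-- f^*(x) = conj (f (−x)). -/
def starF {n : ℕ} (f : Euc n → ℂ) : Euc n → ℂ := fun x => (starRingEnd ℂ) (f (-x))

/-- The monomial x ↦ x^α for a multi-index α. -/
def monom {n : ℕ} (α : Fin n → ℕ) (x : Euc n) : ℂ := ∏ i, (x i : ℂ) ^ α i

/-- f has vanishing moments of order k: ∫ f(x) x^α dx = 0 (converging absolutely)
for all multi-indices α with |α| ≤ k − 1, i.e. |α| < k. -/
def HasVanishingMoments {n : ℕ} (k : ℕ) (f : Euc n → ℂ) : Prop :=
  ∀ α : Fin n → ℕ, (∑ i, α i) < k →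
    Integrable (fun x => f x * monom α x) ∧ (∫ x, f x * monom α x) = 0

/-- All moments of f vanish (with absolute convergence of all the integrals). -/
def AllMomentsVanish {n : ℕ} (f : Euc n → ℂ) : Prop :=
  ∀ α : Fin n → ℕ,
    Integrable (fun x => f x * monom α x) ∧ (∫ x, f x * monom α x) = 0

/-- f has decay order N: |f(x)| ≤ C (1 + |x|)^{−N}. -/
def HasDecayOrder {n : ℕ} (N : ℕ) (f : Euc n → ℂ) : Prop :=
  ∃ C : ℝ, ∀ x, ‖f x‖ ≤ C / (1 + ‖x‖) ^ N

/-- Partial derivative in the i-th coordinate direction. -/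
def pd {n : ℕ} (i : Fin n) (f : Euc n → ℂ) : Euc n → ℂ :=
  fun x => fderiv ℝ f x (EuclideanSpace.single i (1 : ℝ))

/-- Iterated partial derivative ∂^α along a multi-index α. -/
def mderiv {n : ℕ} (α : Fin n → ℕ) (f : Euc n → ℂ) : Euc n → ℂ :=
  (List.finRange n).foldr (fun i g => (pd i)^[α i] g) f

/-- Schwartz-type seminorm (valued in [0,∞]): sup over x of (1+|x|)^k ‖D^m f(x)‖. -/
def schwartzSemi {n : ℕ} (k m : ℕ) (f : Euc n → ℂ) : ℝ≥0∞ :=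
  ⨆ x, ENNReal.ofReal ((1 + ‖x‖) ^ k * ‖iteratedFDeriv ℝ m f x‖)

/-- Convergence in the topology of the Schwartz space, along a filter `l`:
all Schwartz seminorms of the difference tend to 0. -/
def TendstoSchwartz {n : ℕ} {ι : Type*} (l : Filter ι) (F : ι → Euc n → ℂ)
    (f : Euc n → ℂ) : Prop :=
  ∀ k m : ℕ, Tendsto (fun N => schwartzSemi k m (fun x => F N x - f x)) l (nhds 0)

/-- A pair (ψ, η) of Schwartz functions is LP-admissible: for every Schwartz function f
with all moments vanishing, ∑_{|j| ≤ N} f ∗ ψ_j^* ∗ η_j → f in the Schwartz topology. -/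
def LPAdmissible {n : ℕ} (ψ η : 𝓢(Euc n, ℂ)) : Prop :=
  ∀ f : 𝓢(Euc n, ℂ), AllMomentsVanish (⇑f) →
    TendstoSchwartz atTop
      (fun N : ℕ => fun x => ∑ j ∈ Finset.Icc (-(N : ℤ)) (N : ℤ),
        conv (conv (⇑f) (starF (dil n ((2:ℝ) ^ j) (⇑ψ)))) (dil n ((2:ℝ) ^ j) (⇑η)) x)
      (⇑f)

/-- A Schwartz function ψ is admissible: for every Schwartz f with all moments vanishing,
∫_ε^A f ∗ D_a(ψ^* ∗ ψ) da/a → f in the Schwartz topology as ε → 0⁺, A → ∞. -/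
def Admissible {n : ℕ} (ψ : 𝓢(Euc n, ℂ)) : Prop :=
  ∀ f : 𝓢(Euc n, ℂ), AllMomentsVanish (⇑f) →
    TendstoSchwartz ((nhdsWithin (0:ℝ) (Set.Ioi 0)) ×ˢ (atTop : Filter ℝ))
      (fun εA : ℝ × ℝ => fun x =>
        ∫ a in Set.Ioc εA.1 εA.2, conv (⇑f) (dil n a (conv (starF ⇑ψ) ⇑ψ)) x / (a : ℂ))
      (⇑f)

/-! ### Iterated partial derivatives -/

lemma contDiff_pd {n : ℕ} {m : ℕ} {g : Euc n → ℂ} (hg : ContDiff ℝ (m + 1 : ℕ) g) (i : Fin n) :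
    ContDiff ℝ m (pd i g) :=
  (hg.fderiv_right (m := m) (by norm_cast)).clm_apply contDiff_const

lemma contDiff_foldr_pd {n : ℕ} (l : List (Fin n)) {m : ℕ} {g : Euc n → ℂ}
    (hg : ContDiff ℝ (m + l.length : ℕ) g) : ContDiff ℝ m (l.foldr pd g) := by
  induction l generalizing m with
  | nil => simpa using hg
  | cons i l ih =>
    refine contDiff_pd (ih ?_) i
    rwa [List.length_cons, ← add_assoc, add_right_comm] at hg

lemma pd_pd_apply {n : ℕ} {g : Euc n → ℂ} (hg : ContDiff ℝ 2 g) (i j : Fin n) (x : Euc n) :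
    pd i (pd j g) x = fderiv ℝ (fderiv ℝ g) x (EuclideanSpace.single i 1)
      (EuclideanSpace.single j 1) := by
  have hd : DifferentiableAt ℝ (fderiv ℝ g) x :=
    (hg.fderiv_right (m := 1) (by norm_num)).differentiable (by norm_num) x
  change fderiv ℝ (fun y => fderiv ℝ g y (EuclideanSpace.single j 1)) x _ = _
  rw [fderiv_clm_apply hd (differentiableAt_const _)]
  simp

lemma pd_comm {n : ℕ} {g : Euc n → ℂ} (hg : ContDiff ℝ 2 g) (i j : Fin n) :
    pd i (pd j g) = pd j (pd i g) := by
  funext x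
  rw [pd_pd_apply hg, pd_pd_apply hg]
  exact (hg.contDiffAt.isSymmSndFDerivAt (by simp)).eq _ _

lemma foldr_pd_perm {n : ℕ} {l l' : List (Fin n)} (h : l.Perm l') {g : Euc n → ℂ}
    (hg : ContDiff ℝ l.length g) : l.foldr pd g = l'.foldr pd g := by
  induction h with
  | nil => rfl
  | cons i _ ih =>
    rw [List.foldr_cons, List.foldr_cons, ih (hg.of_le (by simp))]
  | swap i j l =>
    refine pd_comm (contDiff_foldr_pd l (m := 2) ?_) j i
    rwa [List.length_cons, List.length_cons, add_assoc, add_comm] at hg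
  | trans h₁ _ ih₁ ih₂ => exact (ih₁ hg).trans (ih₂ (h₁.length_eq ▸ hg))

lemma mderiv_eq_foldr_pd {n : ℕ} (α : Fin n → ℕ) (g : Euc n → ℂ) :
    mderiv α g = ((List.finRange n).flatMap fun i => List.replicate (α i) i).foldr pd g := by
  rw [List.foldr_flatMap, mderiv]
  congr 1
  funext i h
  induction α i with
  | zero => rfl
  | succ m ih => rw [Function.iterate_succ_apply', ih, List.replicate_succ, List.foldr_cons]

/-- The multi-index counting the occurrences of each coordinate in a tuple of coordinates. -/
def tupleIndex {n j : ℕ} (r : Fin j → Fin n) (i : Fin n) : ℕ :=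
  (Finset.univ.filter fun a => r a = i).card

lemma sum_tupleIndex {n j : ℕ} (r : Fin j → Fin n) : ∑ i, tupleIndex r i = j := by
  simpa [tupleIndex] using
    (Finset.card_eq_sum_card_fiberwise (f := r) (s := Finset.univ) (t := Finset.univ)
      (by simp)).symm

lemma monom_tupleIndex {n j : ℕ} (r : Fin j → Fin n) (x : Euc n) :
    monom (tupleIndex r) x = ∏ a, (x (r a) : ℂ) := by
  rw [monom, ← Finset.prod_fiberwise_of_maps_to (s := Finset.univ) (t := Finset.univ) (g := r)
    (by simp)]
  refine Finset.prod_congr rfl fun i _ => ?_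
  rw [Finset.prod_congr rfl (g := fun _ => (x i : ℂ))
    (fun a ha => by rw [(Finset.mem_filter.1 ha).2]), Finset.prod_const, tupleIndex]

lemma ofFn_perm_flatMap_replicate {n j : ℕ} (r : Fin j → Fin n) :
    (List.ofFn r).Perm
      ((List.finRange n).flatMap fun i => List.replicate (tupleIndex r i) i) := by
  rw [List.perm_iff_count]
  intro i
  have h₁ : List.count i (List.ofFn r) = tupleIndex r i := by
    rw [← Multiset.coe_count, ← Fin.univ_val_map, Multiset.count_map, tupleIndex]
    simp only [eq_comm, Finset.card_def, Finset.filter_val]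
  have h₂ : (List.count i ∘ fun a => List.replicate (tupleIndex r a) a) =
      fun a => if a = i then tupleIndex r i else 0 := by
    funext a
    by_cases h : a = i
    · subst h; simp
    · simp [List.count_replicate, h]
  rw [h₁, List.count_flatMap, h₂, ← List.ofFn_eq_map, List.sum_ofFn]
  simp

lemma iteratedFDeriv_apply_single {n : ℕ} {j : ℕ} (r : Fin j → Fin n) {g : Euc n → ℂ}
    (hg : ContDiff ℝ j g) (x : Euc n) :
    iteratedFDeriv ℝ j g x (fun a => EuclideanSpace.single (r a) 1) =
      (List.ofFn r).foldr pd g x := by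
  induction j generalizing x with
  | zero => simp
  | succ j ih =>
    have hd : DifferentiableAt ℝ (iteratedFDeriv ℝ j g) x :=
      hg.contDiffAt.differentiableAt_iteratedFDeriv (by norm_cast; exact j.lt_succ_self)
    rw [hd.iteratedFDeriv_succ_apply_left', List.ofFn_succ, List.foldr_cons, pd,
      ← funext (ih (fun a => r a.succ) (hg.of_le (by norm_cast; exact j.le_succ)))]
    rfl

lemma iteratedFDeriv_apply_single_eq_mderiv {n : ℕ} {j : ℕ} (r : Fin j → Fin n) {g : Euc n → ℂ}
    (hg : ContDiff ℝ j g) (x : Euc n) :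
    iteratedFDeriv ℝ j g x (fun a => EuclideanSpace.single (r a) 1) =
      mderiv (tupleIndex r) g x := by
  rw [iteratedFDeriv_apply_single r hg, mderiv_eq_foldr_pd,
    foldr_pd_perm (ofFn_perm_flatMap_replicate r) (by simpa using hg)]

lemma multilinear_apply_const_eq_sum {n j : ℕ}
    (φ : ContinuousMultilinearMap ℝ (fun _ : Fin j => Euc n) ℂ) (h : Euc n) :
    φ (fun _ => h) = ∑ r : Fin j → Fin n,
      monom (tupleIndex r) h * φ (fun a => EuclideanSpace.single (r a) 1) := by
  have hh : h = ∑ i, h i • EuclideanSpace.single i (1 : ℝ) := by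
    simpa using ((EuclideanSpace.basisFun (Fin n) ℝ).sum_repr h).symm
  conv_lhs => rw [hh]
  rw [φ.map_sum]
  refine Finset.sum_congr rfl fun r _ => ?_
  rw [φ.map_smul_univ, monom_tupleIndex, Complex.real_smul]
  push_cast
  rfl

/-! ### Taylor expansion with decay -/

lemma norm_monom_tupleIndex_le {n j : ℕ} (r : Fin j → Fin n) (h : Euc n) :
    ‖monom (tupleIndex r) h‖ ≤ ‖h‖ ^ j := by
  rw [monom_tupleIndex, norm_prod]
  calc ∏ a, ‖((h (r a) : ℝ) : ℂ)‖ ≤ ∏ _a : Fin j, ‖h‖ := by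
        refine Finset.prod_le_prod (fun _ _ => norm_nonneg _) fun a _ => ?_
        rw [Complex.norm_real]
        exact PiLp.norm_apply_le h (r a)
    _ = ‖h‖ ^ j := by simp

/-- Decay of the partial derivatives of order `k` gives decay of the `k`-th Fréchet derivative. -/
lemma exists_norm_iteratedFDeriv_apply_le {n k N : ℕ} {g : Euc n → ℂ} (hg : ContDiff ℝ k g)
    (hg_decay : ∀ α : Fin n → ℕ, (∑ i, α i) ≤ k →
      ∃ Cα : ℝ, ∀ x, ‖mderiv α g x‖ ≤ Cα / (1 + ‖x‖) ^ N) :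
    ∃ K : ℝ, 0 ≤ K ∧ ∀ x h : Euc n,
      ‖iteratedFDeriv ℝ k g x (fun _ => h)‖ ≤ K * ‖h‖ ^ k / (1 + ‖x‖) ^ N := by
  choose C hC using fun r : Fin k → Fin n => hg_decay (tupleIndex r) (sum_tupleIndex r).le
  have hC0 : ∀ r, 0 ≤ C r := fun r => by
    have := (norm_nonneg _).trans (hC r 0)
    simpa using this
  refine ⟨∑ r, C r, Finset.sum_nonneg fun r _ => hC0 r, fun x h => ?_⟩
  rw [multilinear_apply_const_eq_sum, Finset.sum_mul, Finset.sum_div]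
  refine (norm_sum_le _ _).trans (Finset.sum_le_sum fun r _ => ?_)
  rw [norm_mul, iteratedFDeriv_apply_single_eq_mderiv r hg, mul_comm (C r), mul_div_assoc]
  gcongr
  · exact norm_monom_tupleIndex_le r h
  · exact hC r x

/-- The Taylor polynomial of `g` at `x`, of degree less than `k`, in the increment `h`. -/
def taylorPoly {n : ℕ} (k : ℕ) (g : Euc n → ℂ) (x h : Euc n) : ℂ :=
  ∑ j ∈ Finset.range k, ((j.factorial : ℝ)⁻¹) • iteratedFDeriv ℝ j g x (fun _ => h)

lemma one_add_norm_le_mul {n : ℕ} (x h : Euc n) :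
    1 + ‖x‖ ≤ (1 + ‖x + h‖) * (1 + ‖h‖) := by
  have : ‖x‖ ≤ ‖x + h‖ + ‖h‖ := by simpa using norm_sub_le (x + h) h
  nlinarith [norm_nonneg h, norm_nonneg (x + h)]

lemma inv_one_add_norm_pow_le {n : ℕ} (N : ℕ) (x h : Euc n) {b : ℝ} (hb : ‖h‖ ≤ b) :
    ((1 + ‖x + h‖) ^ N)⁻¹ ≤ (1 + b) ^ N / (1 + ‖x‖) ^ N := by
  rw [le_div_iff₀ (by positivity), inv_mul_le_iff₀ (by positivity), ← mul_pow]
  gcongr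
  exact (one_add_norm_le_mul x h).trans (by gcongr)

lemma exists_norm_sub_taylorPoly_le {n k N : ℕ} {g : Euc n → ℂ} (hg : ContDiff ℝ k g)
    (hg_decay : ∀ α : Fin n → ℕ, (∑ i, α i) ≤ k →
      ∃ Cα : ℝ, ∀ x, ‖mderiv α g x‖ ≤ Cα / (1 + ‖x‖) ^ N) :
    ∃ K : ℝ, 0 ≤ K ∧ ∀ x h : Euc n,
      ‖g (x + h) - taylorPoly k g x h‖ ≤ K * ‖h‖ ^ k * (1 + ‖h‖) ^ N / (1 + ‖x‖) ^ N := by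
  obtain ⟨K, hK0, hK⟩ := exists_norm_iteratedFDeriv_apply_le hg hg_decay
  refine ⟨K, hK0, fun x h => ?_⟩
  have key : ∀ s ∈ Set.Icc (0 : ℝ) 1, ‖iteratedFDeriv ℝ k g (x + s • h) (fun _ => h)‖ ≤
      K * ‖h‖ ^ k * (1 + ‖h‖) ^ N / (1 + ‖x‖) ^ N := by
    intro s hs
    refine (hK _ _).trans ?_
    rw [div_eq_mul_inv, mul_div_assoc]
    gcongr
    apply inv_one_add_norm_pow_le
    rw [norm_smul, Real.norm_of_nonneg hs.1]
    exact mul_le_of_le_one_left (norm_nonneg _) hs.2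
  cases k with
  | zero => simpa [taylorPoly] using key 1 (by simp)
  | succ m =>
    rw [map_add_eq_sum_add_integral_iteratedFDeriv (f := g) (x := x) (y := h) (n := m)
      (fun _ _ => by exact_mod_cast hg.contDiffAt), taylorPoly, add_sub_cancel_left, norm_smul]
    set B := K * ‖h‖ ^ (m + 1) * (1 + ‖h‖) ^ N / (1 + ‖x‖) ^ N
    have hB : 0 ≤ B := by positivity
    have hi : ‖∫ s in (0 : ℝ)..1, (1 - s) ^ m •
        iteratedFDeriv ℝ (m + 1) g (x + s • h) (fun _ => h)‖ ≤ B * |1 - 0| := by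
      refine intervalIntegral.norm_integral_le_of_norm_le_const fun s hs => ?_
      rw [Set.uIoc_of_le zero_le_one] at hs
      rw [norm_smul, norm_pow, Real.norm_of_nonneg (by linarith [hs.2])]
      exact (mul_le_of_le_one_left (norm_nonneg _)
        (pow_le_one₀ (by linarith [hs.2]) (by linarith [hs.1]))).trans
        (key s ⟨hs.1.le, hs.2⟩)
    have hf : ‖((m.factorial : ℝ)⁻¹)‖ ≤ 1 := by
      rw [norm_inv, Real.norm_natCast]
      exact inv_le_one_of_one_le₀ (by exact_mod_cast m.factorial_pos)
    calc _ ≤ 1 * (B * |1 - 0|) := by gcongr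
      _ = B := by simp

/-! ### Vanishing moments -/

lemma HasVanishingMoments.integral_mul_multilinear {n k j : ℕ} {f : Euc n → ℂ}
    (hf : HasVanishingMoments k f) (hj : j < k)
    (φ : ContinuousMultilinearMap ℝ (fun _ : Fin j => Euc n) ℂ) :
    Integrable (fun z => f z * φ (fun _ => z)) ∧ ∫ z, f z * φ (fun _ => z) = 0 := by
  have heq : (fun z => f z * φ (fun _ => z)) = fun z => ∑ r : Fin j → Fin n,
      (f z * monom (tupleIndex r) z) * φ (fun a => EuclideanSpace.single (r a) 1) := by
    funext z
    rw [multilinear_apply_const_eq_sum, Finset.mul_sum]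
    simp only [mul_assoc]
  have h := fun r : Fin j → Fin n => hf (tupleIndex r) ((sum_tupleIndex r).trans_lt hj)
  rw [heq]
  refine ⟨integrable_finsetSum _ fun r _ => (h r).1.mul_const _, ?_⟩
  rw [integral_finsetSum _ fun r _ => (h r).1.mul_const _]
  exact Finset.sum_eq_zero fun r _ => by rw [integral_mul_const, (h r).2, zero_mul]

lemma HasVanishingMoments.integral_mul_taylorPoly {n k : ℕ} {f : Euc n → ℂ}
    (hf : HasVanishingMoments k f) (g : Euc n → ℂ) (x : Euc n) (c : ℝ) :
    Integrable (fun z => f z * taylorPoly k g x (c • z)) ∧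
      ∫ z, f z * taylorPoly k g x (c • z) = 0 := by
  have heq : (fun z => f z * taylorPoly k g x (c • z)) = fun z => ∑ j ∈ Finset.range k,
      ((j.factorial : ℝ)⁻¹ * c ^ j) • (f z * iteratedFDeriv ℝ j g x (fun _ => z)) := by
    funext z
    rw [taylorPoly, Finset.mul_sum]
    refine Finset.sum_congr rfl fun j _ => ?_
    rw [(iteratedFDeriv ℝ j g x).map_smul_univ (fun _ => c) (fun _ => z)]
    simp only [Finset.prod_const, Finset.card_univ, Fintype.card_fin, mul_smul, mul_smul_comm]
  have h := fun j (hj : j ∈ Finset.range k) =>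
    hf.integral_mul_multilinear (Finset.mem_range.1 hj) (iteratedFDeriv ℝ j g x)
  rw [heq]
  refine ⟨integrable_finsetSum _ fun j hj => (h j hj).1.fun_smul _, ?_⟩
  rw [integral_finsetSum _ fun j hj => (h j hj).1.fun_smul _]
  exact Finset.sum_eq_zero fun j hj => by rw [integral_smul, (h j hj).2, smul_zero]

/-! ### The convolution estimate -/

lemma conv_dil_eq {n : ℕ} (f g : Euc n → ℂ) {t : ℝ} (ht : 0 < t) (x : Euc n) :
    conv g (dil n t f) x = ∫ z, f z * g (x + (-t⁻¹) • z) := by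
  have h₁ : conv g (dil n t f) x = ∫ y, g (x - y) * dil n t f y := by
    rw [conv, ← integral_sub_left_eq_self _ volume x]
    simp
  have h₂ := Measure.integral_comp_smul (volume : Measure (Euc n))
    (fun z => t ^ n • (f z * g (x + (-t⁻¹) • z))) t
  rw [integral_smul, integral_smul, finrank_euclideanSpace_fin, abs_of_pos (by positivity), smul_smul,
    inv_mul_cancel₀ (by positivity), one_smul] at h₂
  rw [h₁, ← h₂, ← integral_smul]
  refine integral_congr_ae (Eventually.of_forall fun y => ?_)
  have hy : (-t⁻¹) • t • y = -y := by
    rw [smul_smul, neg_mul, inv_mul_cancel₀ ht.ne', neg_one_smul]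
  simp only [dil, hy, ← sub_eq_add_neg, mul_smul_comm]
  rw [mul_comm]

lemma integrable_inv_one_add_norm_pow {n M : ℕ} (hM : n < M) :
    Integrable (fun x : Euc n => ((1 + ‖x‖) ^ M)⁻¹) := by
  have := integrable_one_add_norm (E := Euc n) (μ := volume) (r := M)
    (by rw [finrank_euclideanSpace_fin]; exact_mod_cast hM)
  simpa [Real.rpow_neg, add_nonneg, Real.rpow_natCast] using this

lemma exists_norm_conv_dil_le {n k N : ℕ} {f g : Euc n → ℂ} (hg_smooth : ContDiff ℝ k g)
    (hg_decay : ∀ α : Fin n → ℕ, (∑ i, α i) ≤ k →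
      ∃ Cα : ℝ, ∀ x, ‖mderiv α g x‖ ≤ Cα / (1 + ‖x‖) ^ N)
    (hf_meas : Measurable f) (hf_mom : HasVanishingMoments k f)
    (hf_decay : HasDecayOrder (N + k + n + 1) f) :
    ∃ A : ℝ, 0 ≤ A ∧ ∀ t : ℝ, 1 < t → ∀ x : Euc n,
      ‖conv g (dil n t f) x‖ ≤ A * (t ^ k)⁻¹ * ((1 + ‖x‖) ^ N)⁻¹ := by
  obtain ⟨K, hK0, hK⟩ := exists_norm_sub_taylorPoly_le hg_smooth hg_decay
  obtain ⟨C, hC⟩ := hf_decay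
  have hC0 : 0 ≤ C := by simpa using (norm_nonneg _).trans (hC 0)
  have hint := integrable_inv_one_add_norm_pow n.lt_succ_self
  refine ⟨C * K * ∫ z : Euc n, ((1 + ‖z‖) ^ (n + 1))⁻¹, by positivity, fun t ht x => ?_⟩
  have ht0 : 0 < t := one_pos.trans ht
  set B : ℝ := C * K * (t ^ k)⁻¹ * ((1 + ‖x‖) ^ N)⁻¹ with hB
  have hbound : ∀ z : Euc n,
      ‖f z * (g (x + (-t⁻¹) • z) - taylorPoly k g x ((-t⁻¹) • z))‖ ≤
        B * ((1 + ‖z‖) ^ (n + 1))⁻¹ := by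
    intro z
    have hz : ‖(-t⁻¹) • z‖ = t⁻¹ * ‖z‖ := by
      rw [norm_smul, norm_neg, Real.norm_of_nonneg (by positivity)]
    have hz' : t⁻¹ * ‖z‖ ≤ ‖z‖ :=
      mul_le_of_le_one_left (norm_nonneg _) (inv_le_one_of_one_le₀ ht.le)
    have h₁ := hK x ((-t⁻¹) • z)
    rw [hz] at h₁
    have h₂ : ‖g (x + (-t⁻¹) • z) - taylorPoly k g x ((-t⁻¹) • z)‖ ≤
        K * ((t ^ k)⁻¹ * (1 + ‖z‖) ^ k) * (1 + ‖z‖) ^ N / (1 + ‖x‖) ^ N := by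
      refine h₁.trans ?_
      rw [mul_pow, inv_pow]
      gcongr
      linarith
    rw [norm_mul]
    calc _ ≤ C / (1 + ‖z‖) ^ (N + k + n + 1) *
          (K * ((t ^ k)⁻¹ * (1 + ‖z‖) ^ k) * (1 + ‖z‖) ^ N / (1 + ‖x‖) ^ N) := by
          gcongr
          exact hC z
      _ = B * ((1 + ‖z‖) ^ (n + 1))⁻¹ := by
          have : 1 + ‖z‖ ≠ 0 := by positivity
          rw [hB]
          field_simp
          ring
  have hcont : Continuous fun z : Euc n =>
      g (x + (-t⁻¹) • z) - taylorPoly k g x ((-t⁻¹) • z) := by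
    refine (hg_smooth.continuous.comp (by fun_prop)).sub ?_
    unfold taylorPoly
    refine continuous_finsetSum _ fun j _ => Continuous.fun_const_smul ?_ _
    exact (iteratedFDeriv ℝ j g x).cont.comp (by fun_prop)
  have hrem : Integrable fun z : Euc n =>
      f z * (g (x + (-t⁻¹) • z) - taylorPoly k g x ((-t⁻¹) • z)) :=
    (hint.const_mul B).mono' (hf_meas.aestronglyMeasurable.mul hcont.aestronglyMeasurable)
      (Eventually.of_forall hbound)
  obtain ⟨hT, hT0⟩ := hf_mom.integral_mul_taylorPoly g x (-t⁻¹)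
  have hconv : conv g (dil n t f) x =
      ∫ z, f z * (g (x + (-t⁻¹) • z) - taylorPoly k g x ((-t⁻¹) • z)) := by
    rw [conv_dil_eq f g ht0, ← add_zero (∫ z, f z * (_ - _)), ← hT0, ← integral_add hrem hT]
    refine integral_congr_ae (Eventually.of_forall fun z => ?_)
    simp only []
    ring
  rw [hconv]
  refine (norm_integral_le_of_norm_le (hint.const_mul B) (Eventually.of_forall hbound)).trans ?_
  rw [integral_const_mul, hB]
  apply le_of_eq
  ring

lemma memLp_inv_one_add_norm_pow {n N : ℕ} {p : ℝ≥0∞} (hp : 1 ≤ p)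
    (hNp : p = ⊤ ∨ (n : ℝ) < (N : ℝ) * p.toReal) :
    MemLp (fun x : Euc n => ((1 + ‖x‖) ^ N)⁻¹) p := by
  have hmeas : AEStronglyMeasurable (fun x : Euc n => ((1 + ‖x‖) ^ N)⁻¹) :=
    Measurable.aestronglyMeasurable (by fun_prop)
  by_cases hp_top : p = ⊤
  · subst hp_top
    refine memLp_top_of_bound hmeas 1 (Eventually.of_forall fun x => ?_)
    rw [Real.norm_of_nonneg (by positivity)]
    exact inv_le_one_of_one_le₀ (one_le_pow₀ (by linarith [norm_nonneg x]))
  · rw [← integrable_norm_rpow_iff hmeas (one_pos.trans_le hp).ne' hp_top]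
    have h := integrable_one_add_norm (E := Euc n) (μ := volume) (r := N * p.toReal)
      (by rw [finrank_euclideanSpace_fin]; exact hNp.resolve_left hp_top)
    refine h.congr (Eventually.of_forall fun x => ?_)
    have hx : 0 ≤ 1 + ‖x‖ := by positivity
    simp only []
    rw [Real.norm_of_nonneg (by positivity), Real.inv_rpow (by positivity), Real.rpow_neg hx,
      Real.rpow_mul hx, Real.rpow_natCast]

/-- Lemma 3.12(b) of the paper (L^p estimate), for G = ℝⁿ:
‖g ∗ D_t f‖_p ≤ C' t^{−k} for t > 1, provided N p > n
(which holds automatically for p = ∞). -/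
theorem statement2 (n : ℕ) (hn : 1 ≤ n) (k N : ℕ) (f g : Euc n → ℂ)
    (hg_smooth : ContDiff ℝ k g)
    (hg_decay : ∀ α : Fin n → ℕ, (∑ i, α i) ≤ k →
      ∃ Cα : ℝ, ∀ x, ‖mderiv α g x‖ ≤ Cα / (1 + ‖x‖) ^ N)
    (hf_meas : Measurable f)
    (hf_mom : HasVanishingMoments k f)
    (hf_decay : HasDecayOrder (N + k + n + 1) f)
    (p : ℝ≥0∞) (hp : 1 ≤ p)
    (hNp : p = ⊤ ∨ (n : ℝ) < (N : ℝ) * p.toReal) :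
    ∃ C' : ℝ, 0 < C' ∧ ∀ t : ℝ, 1 < t →
      eLpNorm (conv g (dil n t f)) p volume
        ≤ ENNReal.ofReal (C' * t ^ (-(k : ℝ))) := by
  obtain ⟨A, hA0, hA⟩ := exists_norm_conv_dil_le hg_smooth hg_decay hf_meas hf_mom hf_decay
  have hw := memLp_inv_one_add_norm_pow (n := n) hp hNp
  set w : Euc n → ℝ := fun x => ((1 + ‖x‖) ^ N)⁻¹
  refine ⟨A * (eLpNorm w p volume).toReal + 1, by positivity, fun t ht => ?_⟩
  have ht0 : 0 < t := one_pos.trans ht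
  calc eLpNorm (conv g (dil n t f)) p volume
      ≤ eLpNorm ((A * (t ^ k)⁻¹) • w) p volume := eLpNorm_mono_real (hA t ht)
    _ = ENNReal.ofReal (A * (eLpNorm w p volume).toReal * (t ^ k)⁻¹) := by
        rw [eLpNorm_const_smul, Real.enorm_of_nonneg (by positivity),
          ← ENNReal.ofReal_toReal hw.2.ne, ← ENNReal.ofReal_mul (by positivity),
          ENNReal.toReal_ofReal ENNReal.toReal_nonneg]
        ring_nf
    _ ≤ _ := by
        rw [Real.rpow_neg ht0.le, Real.rpow_natCast]
        gcongr
        linarith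

end
end

section
/- Let ψ be a Schwartz function on ℝ whose Fourier transform ψ̂ (with convention ψ̂(ξ) = ∫_ℝ ψ(x) e^{-2πi x ξ} dx) is smooth, compactly supported, vanishes identically on a neighborhood of 0, and satisfies ∑_{j∈ℤ} |ψ̂(2^j ξ)|² = 1 for every ξ ≠ 0. Then: (i) ψ has all moments vanishing, i.e. ∫_ℝ ψ(x) x^m dx = 0 for every m ∈ ℕ; (ii) for every Schwartz function f on ℝ with all moments vanishing, the partial sums ∑_{|j| ≤ N} f ∗ ψ_j^* ∗ ψ_j converge to f in the topology of the Schwartz space as N → ∞. -/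
open MeasureTheory SchwartzMap Filter Topology FourierTransform
open scoped ENNReal ContDiff

noncomputable section

/-- Convolution on ℝ: (f ∗ g)(x) = ∫ f(y) g(x − y) dy. -/
def conv1 (f g : ℝ → ℂ) : ℝ → ℂ := fun x => ∫ y, f y * g (x - y)

/-- L¹-normalized dilation on ℝ: (D_t f)(x) = t f(t x). -/
def dil1 (t : ℝ) (f : ℝ → ℂ) : ℝ → ℂ := fun x => (t : ℝ) • f (t * x)

/-- f^*(x) = conj (f (−x)). -/
def starF1 (f : ℝ → ℂ) : ℝ → ℂ := fun x => (starRingEnd ℂ) (f (-x))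

/-- All moments of f vanish (with absolute convergence of all the integrals). -/
def AllMomentsVanish1 (f : ℝ → ℂ) : Prop :=
  ∀ m : ℕ, Integrable (fun x : ℝ => f x * (x : ℂ) ^ m) ∧
    (∫ x : ℝ, f x * (x : ℂ) ^ m) = 0

/-- Schwartz-type seminorm (valued in [0,∞]). -/
def schwartzSemi1 (k m : ℕ) (f : ℝ → ℂ) : ℝ≥0∞ :=
  ⨆ x : ℝ, ENNReal.ofReal ((1 + ‖x‖) ^ k * ‖iteratedFDeriv ℝ m f x‖)

/-- Convergence in the topology of the Schwartz space on ℝ, along a filter `l`. -/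
def TendstoSchwartz1 {ι : Type*} (l : Filter ι) (F : ι → ℝ → ℂ) (f : ℝ → ℂ) : Prop :=
  ∀ k m : ℕ, Tendsto (fun N => schwartzSemi1 k m (fun x => F N x - f x)) l (nhds 0)

theorem iteratedDeriv_fourier_zero (f : 𝓢(ℝ, ℂ)) (n : ℕ) :
    iteratedDeriv n (𝓕 (⇑f)) 0 = (-2 * Real.pi * Complex.I) ^ n * ∫ x : ℝ, f x * (x : ℂ) ^ n := by
  rw [Real.iteratedDeriv_fourier (N := ⊤) (n := n) _ le_top, Real.fourier_eq,
    ← integral_const_mul]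
  · simp
    congr 1
    ext x
    ring
  · intro m _
    refine (integrable_norm_iff (by fun_prop)).1 ?_
    simpa [norm_smul] using f.integrable_pow_mul volume m

/-- A Schwartz function all of whose derivatives vanish at the origin is flat there. -/
theorem exists_norm_iteratedDeriv_le_pow (h : 𝓢(ℝ, ℂ)) (h0 : ∀ n, iteratedDeriv n h 0 = 0)
    (L l : ℕ) : ∃ C, 0 ≤ C ∧ ∀ x, ‖iteratedDeriv l h x‖ ≤ C * |x| ^ L := by
  induction L generalizing l with
  | zero =>
    refine ⟨SchwartzMap.seminorm ℝ 0 l h, by positivity, fun x => ?_⟩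
    simpa using h.le_seminorm' ℝ 0 l x
  | succ L ih =>
    obtain ⟨C, hC, hb⟩ := ih (l + 1)
    refine ⟨C, hC, fun x => ?_⟩
    have hd : Differentiable ℝ (iteratedDeriv l h) :=
      (h.smooth ⊤).differentiable_iteratedDeriv l (by exact_mod_cast WithTop.coe_lt_top l)
    have := (convex_uIcc (0 : ℝ) x).norm_image_sub_le_of_norm_deriv_le (𝕜 := ℝ)
      (f := iteratedDeriv l h) (C := C * |x| ^ L) (x := 0) (y := x)
      (fun y _ => hd y) (fun y hy => ?_) (by simp) (by simp)
    · simpa [h0 l, pow_succ, mul_assoc] using this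
    · rw [← iteratedDeriv_succ]
      refine (hb y).trans ?_
      have : |y| ≤ |x| := by simpa using Set.abs_sub_left_of_mem_uIcc hy
      gcongr

/-- Frequency pieces of a flat Schwartz function decay geometrically in every Schwartz seminorm. -/
theorem exists_seminorm_comp_mul_le (φ h : 𝓢(ℝ, ℂ)) (h0 : ∀ n, iteratedDeriv n h 0 = 0)
    {δ R : ℝ} (hδ : 0 < δ) (hR : 0 < R) (hφδ : ∀ ξ, |ξ| < δ → φ ξ = 0)
    (hφR : ∀ ξ, R < |ξ| → φ ξ = 0)
    (k n : ℕ) : ∃ C, ∀ t : ℝ, 0 < t → ∀ g : 𝓢(ℝ, ℂ), (∀ ξ, g ξ = φ (t * ξ) * h ξ) →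
      SchwartzMap.seminorm ℂ k n g ≤ C * min t t⁻¹ := by
  have zδ : ∀ i ξ, |ξ| < δ → iteratedDeriv i φ ξ = 0 := fun i ξ hξ => by
    have : (φ : ℝ → ℂ) =ᶠ[𝓝 ξ] fun _ => 0 := by
      filter_upwards [(isOpen_lt continuous_abs continuous_const).mem_nhds hξ] with y hy
      exact hφδ y hy
    rw [this.iteratedDeriv_eq]; simp
  have zR : ∀ i ξ, R < |ξ| → iteratedDeriv i φ ξ = 0 := fun i ξ hξ => by
    have : (φ : ℝ → ℂ) =ᶠ[𝓝 ξ] fun _ => 0 := by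
      filter_upwards [(isOpen_lt continuous_const continuous_abs).mem_nhds hξ] with y hy
      exact hφR y hy
    rw [this.iteratedDeriv_eq]; simp
  have key : ∀ i l : ℕ, ∃ C, 0 ≤ C ∧ ∀ t : ℝ, 0 < t → ∀ ξ : ℝ,
      |ξ| ^ k * (t ^ i * ‖iteratedDeriv i φ (t * ξ)‖ * ‖iteratedDeriv l h ξ‖)
        ≤ C * min t t⁻¹ := by
    intro i l
    obtain ⟨A, hA, hAb⟩ := exists_norm_iteratedDeriv_le_pow h h0 (i + 1) l
    set B := SchwartzMap.seminorm ℝ 0 i φ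
    have hB0 : 0 ≤ B := by positivity
    have hφB : ∀ ξ, ‖iteratedDeriv i φ ξ‖ ≤ B := fun ξ => by simpa using φ.le_seminorm' ℝ 0 i ξ
    set S := SchwartzMap.seminorm ℝ (k + 1) l h
    have hS0 : 0 ≤ S := by positivity
    have hhS : ∀ ξ, |ξ| ^ (k + 1) * ‖iteratedDeriv l h ξ‖ ≤ S := h.le_seminorm' ℝ (k + 1) l
    refine ⟨R ^ k * B * A * R ^ (i + 1) + B * S / δ, by positivity, fun t ht ξ => ?_⟩
    have hm : 0 ≤ min t t⁻¹ := by positivity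
    rcases lt_or_ge |t * ξ| δ with hlt | hge
    · rw [zδ i _ hlt]; simp only [norm_zero, mul_zero, zero_mul]; positivity
    rcases lt_or_ge R |t * ξ| with hgt | hle
    · rw [zR i _ hgt]; simp only [norm_zero, mul_zero, zero_mul]; positivity
    rw [abs_mul, abs_of_pos ht] at hge hle
    rcases le_total t 1 with h1 | h1
    · have hmin : min t t⁻¹ = t := min_eq_left (h1.trans ((one_le_inv₀ ht).2 h1))
      rw [hmin]
      calc |ξ| ^ k * (t ^ i * ‖iteratedDeriv i φ (t * ξ)‖ * ‖iteratedDeriv l h ξ‖)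
          ≤ |ξ| ^ k * (1 * B * ‖iteratedDeriv l h ξ‖) := by
            gcongr
            · exact pow_le_one₀ ht.le h1
            · exact hφB _
        _ = 1 * (B * (|ξ| ^ k * ‖iteratedDeriv l h ξ‖)) := by ring
        _ ≤ (t * |ξ| / δ) * (B * (|ξ| ^ k * ‖iteratedDeriv l h ξ‖)) := by
            gcongr
            rwa [one_le_div hδ]
        _ = B * (|ξ| ^ (k + 1) * ‖iteratedDeriv l h ξ‖) / δ * t := by ring
        _ ≤ B * S / δ * t := by gcongr; exact hhS ξ
        _ ≤ _ := by
            gcongr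
            exact le_add_of_nonneg_left (by positivity)
    · have hmin : min t t⁻¹ = t⁻¹ := min_eq_right ((inv_le_one_of_one_le₀ h1).trans h1)
      have hξR : |ξ| ≤ R := by nlinarith [abs_nonneg ξ]
      rw [hmin]
      calc |ξ| ^ k * (t ^ i * ‖iteratedDeriv i φ (t * ξ)‖ * ‖iteratedDeriv l h ξ‖)
          ≤ R ^ k * (t ^ i * B * (A * |ξ| ^ (i + 1))) := by
            gcongr
            · exact hφB _
            · exact hAb ξ
        _ = R ^ k * B * A * (t * |ξ|) ^ (i + 1) * t⁻¹ := by field_simp; ring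
        _ ≤ R ^ k * B * A * R ^ (i + 1) * t⁻¹ := by gcongr
        _ ≤ _ := by
            gcongr
            exact le_add_of_nonneg_right (by positivity)
  choose C hC hCb using key
  refine ⟨∑ i ∈ Finset.range (n + 1), n.choose i * C i (n - i), fun t ht g hg => ?_⟩
  have hm : 0 ≤ min t t⁻¹ := by positivity
  refine g.seminorm_le_bound' ℂ k n
    (mul_nonneg (Finset.sum_nonneg fun i _ => mul_nonneg (by positivity) (hC i _)) hm) fun ξ => ?_
  have hgf : (g : ℝ → ℂ) = (fun ξ => φ (t * ξ)) * h := funext hg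
  have hφn : ContDiff ℝ n (φ : ℝ → ℂ) := φ.smooth n
  have hscale : ∀ i ≤ n, iteratedDeriv i (fun ξ => φ (t * ξ)) ξ
      = t ^ i • iteratedDeriv i φ (t * ξ) := fun i _ => by
    have := congrFun (iteratedDeriv_comp_const_smul (φ.smooth i) t) ξ
    simpa using this
  rw [hgf, iteratedDeriv_mul (by fun_prop) (h.smooth n).contDiffAt, Finset.sum_mul]
  calc |ξ| ^ k * ‖∑ i ∈ Finset.range (n + 1), (n.choose i : ℂ) *
          iteratedDeriv i (fun ξ => φ (t * ξ)) ξ * iteratedDeriv (n - i) h ξ‖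
      ≤ |ξ| ^ k * ∑ i ∈ Finset.range (n + 1), ‖(n.choose i : ℂ) *
          iteratedDeriv i (fun ξ => φ (t * ξ)) ξ * iteratedDeriv (n - i) h ξ‖ := by
        gcongr
        exact norm_sum_le _ _
    _ = ∑ i ∈ Finset.range (n + 1), n.choose i * (|ξ| ^ k *
          (t ^ i * ‖iteratedDeriv i φ (t * ξ)‖ * ‖iteratedDeriv (n - i) h ξ‖)) := by
        rw [Finset.mul_sum]
        refine Finset.sum_congr rfl fun i hi => ?_
        rw [hscale i (Nat.lt_succ_iff.1 (Finset.mem_range.1 hi)), norm_mul, norm_mul, norm_smul]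
        simp only [RCLike.norm_natCast, norm_pow, Real.norm_of_nonneg ht.le]
        ring
    _ ≤ ∑ i ∈ Finset.range (n + 1), n.choose i * C i (n - i) * min t t⁻¹ := by
        refine Finset.sum_le_sum fun i _ => ?_
        rw [mul_assoc (n.choose i : ℝ)]
        exact mul_le_mul_of_nonneg_left (hCb i _ t ht ξ) (by positivity)

theorem TendstoSchwartz1.of_tendsto {ι : Type*} {l : Filter ι} {F : ι → 𝓢(ℝ, ℂ)} {f : 𝓢(ℝ, ℂ)}
    (hF : Tendsto F l (𝓝 f)) : TendstoSchwartz1 l (fun N => ⇑(F N)) ⇑f := by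
  intro k m
  rw [ENNReal.tendsto_nhds_zero]
  intro ε hε
  obtain ⟨r, hr0, hr⟩ : ∃ r : ℝ, 0 < r ∧ ENNReal.ofReal r ≤ ε := by
    obtain ⟨r, hr0, hr⟩ := ENNReal.lt_iff_exists_nnreal_btwn.1 hε
    exact ⟨r, by exact_mod_cast hr0, by simpa using hr.le⟩
  have := ((schwartz_withSeminorms ℂ ℝ ℂ).tendsto_nhds' F f).1 hF (Finset.Iic (k, m)) (r / 2 ^ k)
    (by positivity)
  filter_upwards [this] with N hN
  refine iSup_le fun x => (ENNReal.ofReal_le_ofReal ?_).trans hr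
  have h1 := SchwartzMap.one_add_le_sup_seminorm_apply (𝕜 := ℂ) (m := (k, m)) le_rfl le_rfl
    (F N - f) x
  refine h1.trans ?_
  rw [lt_div_iff₀ (by positivity)] at hN
  rw [mul_comm]
  exact hN.le

/-- A series of Schwartz functions that is summable in every seminorm and whose symmetric partial
sums are eventually locally equal to `h` away from the origin converges to `h`. -/
theorem tendsto_sum_Icc_of_seminorm_le {F : ℤ → 𝓢(ℝ, ℂ)} {h : 𝓢(ℝ, ℂ)}
    (hF : ∀ k n, ∃ a : ℤ → ℝ, Summable a ∧ ∀ j, SchwartzMap.seminorm ℂ k n (F j) ≤ a j)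
    (hloc : ∀ ξ : ℝ, ξ ≠ 0 → ∀ᶠ N : ℕ in atTop,
      ⇑(∑ j ∈ Finset.Icc (-(N : ℤ)) N, F j) =ᶠ[𝓝 ξ] ⇑h) :
    Tendsto (fun N : ℕ => ∑ j ∈ Finset.Icc (-(N : ℤ)) N, F j) atTop (𝓝 h) := by
  rw [(schwartz_withSeminorms ℂ ℝ ℂ).tendsto_nhds]
  rintro ⟨k, n⟩ ε hε
  obtain ⟨a, ha, hab⟩ := hF k n
  obtain ⟨s, hs⟩ := summable_iff_vanishing_norm.1 ha (ε / 2) (half_pos hε)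
  obtain ⟨N₀, hN₀⟩ : ∃ N₀ : ℕ, s ⊆ Finset.Icc (-(N₀ : ℤ)) N₀ := by
    refine ⟨s.sup Int.natAbs, fun j hj => ?_⟩
    have := Finset.le_sup (f := Int.natAbs) hj
    rw [Finset.mem_Icc]; omega
  filter_upwards [eventually_ge_atTop N₀] with N hN
  refine lt_of_le_of_lt ?_ (half_lt_self hε)
  set D := (∑ j ∈ Finset.Icc (-(N : ℤ)) N, F j) - h with hD
  have hclosed : IsClosed {ξ : ℝ | |ξ| ^ k * ‖iteratedDeriv n D ξ‖ ≤ ε / 2} := by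
    have hc : Continuous (iteratedDeriv n D) :=
      (D.smooth n).continuous_iteratedDeriv n le_rfl
    exact isClosed_le (by fun_prop) continuous_const
  have hne : ({0}ᶜ : Set ℝ) ⊆ {ξ : ℝ | |ξ| ^ k * ‖iteratedDeriv n D ξ‖ ≤ ε / 2} := by
    intro ξ hξ
    obtain ⟨M, hM, hNM⟩ := ((hloc ξ hξ).and (eventually_ge_atTop N)).exists
    have hsub : Finset.Icc (-(N : ℤ)) N ⊆ Finset.Icc (-(M : ℤ)) M :=
      Finset.Icc_subset_Icc (by omega) (by omega)
    set T := Finset.Icc (-(M : ℤ)) M \ Finset.Icc (-(N : ℤ)) N with hT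
    have hsplit : ∑ j ∈ T, F j + ∑ j ∈ Finset.Icc (-(N : ℤ)) N, F j
        = ∑ j ∈ Finset.Icc (-(M : ℤ)) M, F j := Finset.sum_sdiff hsub
    have hDT : (D : ℝ → ℂ) =ᶠ[𝓝 ξ] ⇑(-∑ j ∈ T, F j) := by
      filter_upwards [hM] with y hy
      rw [hD, sub_apply, ← hy, ← hsplit]
      simp
    have hle : SchwartzMap.seminorm ℂ k n (-∑ j ∈ T, F j) ≤ ε / 2 := by
      rw [map_neg_eq_map]
      refine (Finset.le_sum_of_subadditive (SchwartzMap.seminorm ℂ k n) (map_zero _).le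
        (map_add_le_add _) _ _).trans ?_
      refine (Finset.sum_le_sum fun j _ => hab j).trans ((le_abs_self _).trans (hs T ?_).le)
      exact Finset.disjoint_of_subset_right
        (hN₀.trans (Finset.Icc_subset_Icc (by omega) (by omega))) Finset.sdiff_disjoint
    rw [Set.mem_ofPred_eq, hDT.iteratedDeriv_eq]
    exact (SchwartzMap.le_seminorm' ℂ k n _ ξ).trans hle
  have huniv := hclosed.closure_subset_iff.2 hne
  rw [(dense_compl_singleton (0 : ℝ)).closure_eq] at huniv
  exact D.seminorm_le_bound' ℂ k n (half_pos hε).le fun ξ => huniv (Set.mem_univ ξ)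

/-- The dilate of a Schwartz function by a nonzero factor, as a Schwartz function. -/
def dilSchwartz (t : ℝ) (ht : t ≠ 0) (f : 𝓢(ℝ, ℂ)) : 𝓢(ℝ, ℂ) :=
  t • SchwartzMap.compCLMOfContinuousLinearEquiv ℝ
    (ContinuousLinearEquiv.smulLeft (R₁ := ℝ) (M₁ := ℝ) (Units.mk0 t ht)) f

theorem coe_dilSchwartz (t : ℝ) (ht : t ≠ 0) (f : 𝓢(ℝ, ℂ)) : ⇑(dilSchwartz t ht f) = dil1 t f :=
  rfl

/-- The involution `f ↦ f^*` on Schwartz functions. -/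
def starSchwartz (f : 𝓢(ℝ, ℂ)) : 𝓢(ℝ, ℂ) :=
  (SchwartzMap.compCLMOfContinuousLinearEquiv ℝ (ContinuousLinearEquiv.neg ℝ) f).postcompCLM
    (Complex.conjCLE : ℂ →L[ℝ] ℂ)

theorem coe_starSchwartz (f : 𝓢(ℝ, ℂ)) : ⇑(starSchwartz f) = starF1 f :=
  rfl

theorem fourier_dil1 {t : ℝ} (ht : 0 < t) (f : ℝ → ℂ) (ξ : ℝ) :
    𝓕 (dil1 t f) ξ = 𝓕 f (t⁻¹ * ξ) := by
  rw [Real.fourier_real_eq, Real.fourier_real_eq]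
  have := Measure.integral_comp_mul_left
    (fun y : ℝ => Real.fourierChar (-(y * (t⁻¹ * ξ))) • f y) t
  rw [abs_of_pos (inv_pos.2 ht), eq_inv_smul_iff₀ ht.ne', ← integral_smul] at this
  rw [← this]
  refine integral_congr_ae (.of_forall fun y => ?_)
  have hy : t * y * (t⁻¹ * ξ) = y * ξ := by field_simp
  simp only [dil1, hy]
  rw [smul_comm]

theorem fourier_starF1 (f : ℝ → ℂ) (ξ : ℝ) : 𝓕 (starF1 f) ξ = (starRingEnd ℂ) (𝓕 f ξ) := by
  rw [Real.fourier_real_eq, Real.fourier_real_eq, ← integral_conj,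
    ← integral_neg_eq_self (fun y => (starRingEnd ℂ) (Real.fourierChar (-(y * ξ)) • f y))]
  refine integral_congr_ae (.of_forall fun y => ?_)
  simp [starF1, Circle.smul_def, ← Circle.coe_inv_eq_conj, ← AddChar.map_neg_eq_inv]

theorem conv1_eq_convolution (f g : 𝓢(ℝ, ℂ)) :
    conv1 f g = ⇑(SchwartzMap.convolution (ContinuousLinearMap.mul ℂ ℂ) f g) :=
  funext fun x => (SchwartzMap.convolution_apply (ContinuousLinearMap.mul ℂ ℂ) f g x).symm

theorem fourier_conv_star_conv_dil1 (f ψ : 𝓢(ℝ, ℂ)) {t : ℝ} (ht : 0 < t) (ξ : ℝ) :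
    𝓕 (SchwartzMap.convolution (ContinuousLinearMap.mul ℂ ℂ)
      (SchwartzMap.convolution (ContinuousLinearMap.mul ℂ ℂ) f
        (starSchwartz (dilSchwartz t ht.ne' ψ))) (dilSchwartz t ht.ne' ψ)) ξ
      = (‖𝓕 (⇑ψ) (t⁻¹ * ξ)‖ ^ 2 : ℝ) * 𝓕 f ξ := by
  rw [SchwartzMap.fourier_convolution, SchwartzMap.pairing_apply_apply,
    SchwartzMap.fourier_convolution, SchwartzMap.pairing_apply_apply]
  simp only [ContinuousLinearMap.mul_apply', SchwartzMap.fourier_coe, coe_starSchwartz,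
    coe_dilSchwartz, fourier_starF1, fourier_dil1 ht]
  rw [mul_assoc, Complex.conj_mul', mul_comm]
  push_cast
  rfl

theorem summable_min_two_zpow (C : ℝ) :
    Summable fun j : ℤ => C * min (((2 : ℝ) ^ j)⁻¹) (((2 : ℝ) ^ j)⁻¹)⁻¹ := by
  refine Summable.mul_left C ?_
  have hg : Summable fun n : ℕ => (1 / 2 : ℝ) ^ n := summable_geometric_two
  refine Summable.of_nat_of_neg (hg.of_nonneg_of_le (fun n => by positivity) fun n => ?_)
    (hg.of_nonneg_of_le (fun n => by positivity) fun n => ?_)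
  · exact (min_le_left _ _).trans (by simp)
  · exact (min_le_right _ _).trans (by simp)

/-- Off the origin, the dyadic partition of unity is a locally finite sum. -/
theorem eventually_sum_Icc_eq_one {u : ℝ → ℝ} {δ R : ℝ} (hδ : 0 < δ)
    (huδ : ∀ ξ, |ξ| < δ → u ξ = 0) (huR : ∀ ξ, R < |ξ| → u ξ = 0)
    (hu : ∀ ξ : ℝ, ξ ≠ 0 → ∑' j : ℤ, u ((2 : ℝ) ^ j * ξ) = 1) {ξ : ℝ} (hξ : ξ ≠ 0) :
    ∀ᶠ N : ℕ in atTop, ∀ᶠ η in 𝓝 ξ,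
      ∑ j ∈ Finset.Icc (-(N : ℤ)) N, u (((2 : ℝ) ^ j)⁻¹ * η) = 1 := by
  have h0 : 0 < |ξ| := abs_pos.2 hξ
  have hpow : Tendsto (fun N : ℕ => (2 : ℝ) ^ N) atTop atTop :=
    tendsto_pow_atTop_atTop_of_one_lt one_lt_two
  filter_upwards [hpow.eventually_gt_atTop (R / (|ξ| / 2)),
    hpow.eventually_gt_atTop (2 * |ξ| / δ)] with N hN₁ hN₂
  rw [div_lt_iff₀ (by positivity)] at hN₁ hN₂
  filter_upwards [(isOpen_lt continuous_const continuous_abs).mem_nhds (half_lt_self h0),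
    (isOpen_lt continuous_abs continuous_const).mem_nhds
      (show |ξ| < 2 * |ξ| by linarith)] with η (hη₁ : |ξ| / 2 < |η|) (hη₂ : |η| < 2 * |ξ|)
  have hη : η ≠ 0 := abs_pos.1 (by linarith)
  rw [← hu η hη, ← (Equiv.neg ℤ).tsum_eq, tsum_eq_sum (s := Finset.Icc (-(N : ℤ)) N)]
  · exact Finset.sum_congr rfl fun j _ => by simp
  · intro j hj
    have habs : |(2 : ℝ) ^ (-j) * η| = (2 : ℝ) ^ (-j) * |η| := by
      rw [abs_mul, abs_of_pos (by positivity)]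
    rw [Finset.mem_Icc, not_and_or, not_le, not_le] at hj
    simp only [Equiv.neg_apply]
    rcases hj with hj | hj
    · apply huR
      have : (2 : ℝ) ^ N ≤ (2 : ℝ) ^ (-j) := by
        rw [← zpow_natCast]
        exact zpow_le_zpow_right₀ one_le_two (by omega)
      rw [habs]
      calc R < 2 ^ N * (|ξ| / 2) := hN₁
        _ ≤ _ := by gcongr
    · apply huδ
      have : (2 : ℝ) ^ N ≤ (2 : ℝ) ^ j := by
        rw [← zpow_natCast]
        exact zpow_le_zpow_right₀ one_le_two hj.le
      rw [habs, zpow_neg, inv_mul_lt_iff₀ (by positivity)]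
      calc |η| < 2 * |ξ| := hη₂
        _ < 2 ^ N * δ := hN₂
        _ ≤ _ := by gcongr

/-- Construction of LP-admissible pairs (Lemma 3.6 of the paper) in the case G = ℝ:
if ψ̂ is smooth, compactly supported, vanishes near 0 and ∑_j |ψ̂(2^j ξ)|² = 1 for ξ ≠ 0,
then ψ has all moments vanishing, and (ψ, ψ) is LP-admissible. -/
theorem statement7 (ψ : 𝓢(ℝ, ℂ))
    (h_smooth : ContDiff ℝ ∞ (𝓕 ⇑ψ))
    (h_supp : HasCompactSupport (𝓕 ⇑ψ))
    (h_near0 : ∃ δ : ℝ, 0 < δ ∧ ∀ ξ : ℝ, |ξ| < δ → 𝓕 (⇑ψ) ξ = 0)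
    (h_part : ∀ ξ : ℝ, ξ ≠ 0 → ∑' j : ℤ, ‖𝓕 (⇑ψ) ((2:ℝ) ^ j * ξ)‖ ^ 2 = 1) :
    (∀ m : ℕ, (∫ x : ℝ, ψ x * (x : ℂ) ^ m) = 0) ∧
    (∀ f : 𝓢(ℝ, ℂ), AllMomentsVanish1 (⇑f) →
      TendstoSchwartz1 atTop
        (fun N : ℕ => fun x => ∑ j ∈ Finset.Icc (-(N : ℤ)) (N : ℤ),
          conv1 (conv1 (⇑f) (starF1 (dil1 ((2:ℝ) ^ j) (⇑ψ)))) (dil1 ((2:ℝ) ^ j) (⇑ψ)) x)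
        (⇑f)) := by
  obtain ⟨δ, hδ, hψδ⟩ := h_near0
  obtain ⟨R, hR, hψR⟩ : ∃ R : ℝ, 0 < R ∧ ∀ ξ : ℝ, R < |ξ| → 𝓕 (⇑ψ) ξ = 0 := by
    obtain ⟨R, hR, h⟩ := h_supp.exists_pos_le_norm
    exact ⟨R, hR, fun ξ hξ => h ξ (by simpa using hξ.le)⟩
  refine ⟨fun m => ?_, fun f hf => ?_⟩
  · have h1 := iteratedDeriv_fourier_zero ψ m
    have h2 : 𝓕 (⇑ψ) =ᶠ[𝓝 0] fun _ => 0 := by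
      filter_upwards [(isOpen_lt continuous_abs continuous_const).mem_nhds
        (show |(0 : ℝ)| < δ by simpa using hδ)] with ξ hξ using hψδ ξ hξ
    have h3 : (-2 * Real.pi * Complex.I : ℂ) ≠ 0 := by simp [Real.pi_ne_zero]
    rw [h2.iteratedDeriv_eq] at h1
    exact (mul_eq_zero.1 (h1.symm.trans (by simp))).resolve_left (pow_ne_zero m h3)
  · have h2pos : ∀ j : ℤ, (0 : ℝ) < 2 ^ j := fun j => by positivity
    let M := ContinuousLinearMap.mul ℂ ℂ
    let P : ℤ → 𝓢(ℝ, ℂ) := fun j => dilSchwartz ((2 : ℝ) ^ j) (h2pos j).ne' ψ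
    let S : ℤ → 𝓢(ℝ, ℂ) := fun j =>
      SchwartzMap.convolution M (SchwartzMap.convolution M f (starSchwartz (P j))) (P j)
    have hS : ∀ j ξ, 𝓕 (S j) ξ = (‖𝓕 (⇑ψ) (((2 : ℝ) ^ j)⁻¹ * ξ)‖ ^ 2 : ℝ) * 𝓕 f ξ :=
      fun j ξ => fourier_conv_star_conv_dil1 f ψ (h2pos j) ξ
    have h0 : ∀ n, iteratedDeriv n (⇑(𝓕 f : 𝓢(ℝ, ℂ))) (0 : ℝ) = 0 := fun n => by
      rw [SchwartzMap.fourier_coe, iteratedDeriv_fourier_zero, (hf n).2, mul_zero]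
    have hlim : Tendsto (fun N : ℕ => ∑ j ∈ Finset.Icc (-(N : ℤ)) N, 𝓕 (S j)) atTop
        (𝓝 (𝓕 f)) := by
      let φ : 𝓢(ℝ, ℂ) := SchwartzMap.pairing M
        ((𝓕 ψ).postcompCLM (Complex.conjCLE : ℂ →L[ℝ] ℂ)) (𝓕 ψ)
      have hφ : ∀ ξ, φ ξ = (‖𝓕 (⇑ψ) ξ‖ ^ 2 : ℝ) := fun ξ => by
        simp [φ, M, SchwartzMap.fourier_coe, Complex.conj_mul']
      refine tendsto_sum_Icc_of_seminorm_le (fun k n => ?_) fun ξ hξ => ?_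
      · obtain ⟨C, hC⟩ := exists_seminorm_comp_mul_le φ (𝓕 f) h0 hδ hR
          (fun ξ hξ => by simp [hφ, hψδ ξ hξ]) (fun ξ hξ => by simp [hφ, hψR ξ hξ]) k n
        exact ⟨_, summable_min_two_zpow C, fun j => hC _ (inv_pos.2 (h2pos j)) _ fun ξ => by
          rw [hS, hφ]⟩
      · filter_upwards [eventually_sum_Icc_eq_one (R := R) (u := fun ξ => ‖𝓕 (⇑ψ) ξ‖ ^ 2) hδ
          (fun ξ hξ => by simp [hψδ ξ hξ]) (fun ξ hξ => by simp [hψR ξ hξ]) h_part hξ] with N hN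
        filter_upwards [hN] with η hη
        rw [_root_.sum_apply]
        simp_rw [hS]
        rw [← Finset.sum_mul, ← Complex.ofReal_sum, hη]
        simp
    have hlim' : Tendsto (fun N : ℕ => ∑ j ∈ Finset.Icc (-(N : ℤ)) N, S j) atTop (𝓝 f) := by
      have := ((FourierTransform.fourierInvCLM ℂ 𝓢(ℝ, ℂ)).continuous.tendsto _).comp hlim
      simpa [Function.comp_def] using this
    convert TendstoSchwartz1.of_tendsto hlim' using 3 with N x
    rw [_root_.sum_apply]
    refine Finset.sum_congr rfl fun j _ => ?_
    rw [← coe_dilSchwartz _ (h2pos j).ne', ← coe_starSchwartz, conv1_eq_convolution,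
      conv1_eq_convolution]

end
end
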